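/- Consider [0,1]³ with componentwise Gödel operations (min ⊓, max ⊔, and Gödel implication ⇒ applied in each coordinate), and the operations □(a,b,c) = (b ⊓ c, 1, 1) and ◇(a,b,c) = (b ⊔ c, 0, 0). Let S be the nine-element set { (0,0,0), (1,1,1), (1,0,0), (0,1,1), (0,1/2,1/3), (1,1/2,1/3), (1/2,1/2,1/3), (1/2,0,0), (1/2,1,1) }. Then S contains (0,0,0), (1,1,1) and (0,1/2,1/3), S is closed under componentwise ⊓, ⊔, ⇒ and under ◇, but □(0,1/2,1/3) = (1/3,1,1) ∉ S. (This is the first half of the non-interdefinability lemma: □ is not definable from ◇ in crisp Gödel-Kripke semantics.) -/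

import Mathlib

open unitInterval

instance : Fact ((0:ℝ) ≤ 1) := ⟨zero_le_one⟩

noncomputable instance : CompleteLattice unitInterval := Set.Icc.completeLattice

/-- Gödel implication on the unit interval. -/
noncomputable def gimp (a b : unitInterval) : unitInterval := if a ≤ b then 1 else b

infixr:60 " ⇒ " => gimp

/-- Gödel negation on the unit interval. -/
noncomputable def gneg (a : unitInterval) : unitInterval := a ⇒ 0

abbrev G3 := unitInterval × unitInterval × unitInterval

/-- componentwise Gödel implication on `[0,1]³`. -/
noncomputable def gimp3 (x y : G3) : G3 := (x.1 ⇒ y.1, x.2.1 ⇒ y.2.1, x.2.2 ⇒ y.2.2)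

/-- the box operation of the complex algebra of the frame x → y, x → z. -/
noncomputable def box3 (x : G3) : G3 := (x.2.1 ⊓ x.2.2, 1, 1)

/-- the diamond operation of the complex algebra of the frame x → y, x → z. -/
noncomputable def dia3 (x : G3) : G3 := (x.2.1 ⊔ x.2.2, 0, 0)

noncomputable def uhalf : unitInterval := ⟨1/2, by norm_num⟩
noncomputable def uthird : unitInterval := ⟨1/3, by norm_num⟩

noncomputable def S12 : Set G3 :=
  {(0,0,0), (1,1,1), (1,0,0), (0,1,1), (0,uhalf,uthird), (1,uhalf,uthird),
   (uhalf,uhalf,uthird), (uhalf,0,0), (uhalf,1,1)}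

lemma uthird_lt_uhalf : uthird < uhalf :=
  Subtype.mk_lt_mk.mpr (by norm_num)

lemma uthird_pos : 0 < uthird :=
  Subtype.mk_lt_mk.mpr (by norm_num)

lemma uhalf_pos : 0 < uhalf :=
  uthird_pos.trans uthird_lt_uhalf

lemma uhalf_lt_one : uhalf < 1 :=
  Subtype.mk_lt_mk.mpr (by norm_num)

lemma uthird_lt_one : uthird < 1 :=
  uthird_lt_uhalf.trans uhalf_lt_one

lemma gimp_of_le {a b : unitInterval} (h : a ≤ b) : (a ⇒ b) = 1 := if_pos h

lemma gimp_of_lt {a b : unitInterval} (h : b < a) : (a ⇒ b) = b := if_neg h.not_ge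

/-- `S12` is the product of a three-element chain and a three-element chain of pairs. -/
lemma mem_S12_iff (a b c : unitInterval) :
    (a, b, c) ∈ S12 ↔ (a = 0 ∨ a = uhalf ∨ a = 1) ∧
      (b = 0 ∧ c = 0 ∨ b = uhalf ∧ c = uthird ∨ b = 1 ∧ c = 1) := by
  simp only [S12, Set.mem_insert_iff, Set.mem_singleton_iff, Prod.mk.injEq]
  constructor
  · rintro (h | h | h | h | h | h | h | h | h) <;> simp [h]
  · rintro ⟨rfl | rfl | rfl, ⟨rfl, rfl⟩ | ⟨rfl, rfl⟩ | ⟨rfl, rfl⟩⟩ <;> simp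

/-- A chain of length three containing `0` and `1` is closed under the Gödel operations, and two
such chains of the same shape are traversed in parallel. -/
lemma parallel_chains_closed {h t : unitInterval} (h0 : 0 < h) (h1 : h < 1) (t0 : 0 < t)
    (t1 : t < 1) {a b a' b' : unitInterval}
    (ha : a = 0 ∧ b = 0 ∨ a = h ∧ b = t ∨ a = 1 ∧ b = 1)
    (ha' : a' = 0 ∧ b' = 0 ∨ a' = h ∧ b' = t ∨ a' = 1 ∧ b' = 1) :
    (a ⊓ a' = 0 ∧ b ⊓ b' = 0 ∨ a ⊓ a' = h ∧ b ⊓ b' = t ∨ a ⊓ a' = 1 ∧ b ⊓ b' = 1) ∧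
    (a ⊔ a' = 0 ∧ b ⊔ b' = 0 ∨ a ⊔ a' = h ∧ b ⊔ b' = t ∨ a ⊔ a' = 1 ∧ b ⊔ b' = 1) ∧
    ((a ⇒ a') = 0 ∧ (b ⇒ b') = 0 ∨ (a ⇒ a') = h ∧ (b ⇒ b') = t ∨
      (a ⇒ a') = 1 ∧ (b ⇒ b') = 1) := by
  have key : (a ≤ a' ∧ b ≤ b') ∨ (a' < a ∧ b' < b) := by
    rcases ha with ⟨rfl, rfl⟩ | ⟨rfl, rfl⟩ | ⟨rfl, rfl⟩ <;>
    rcases ha' with ⟨rfl, rfl⟩ | ⟨rfl, rfl⟩ | ⟨rfl, rfl⟩ <;>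
    first
    | exact Or.inl ⟨le_rfl, le_rfl⟩
    | exact Or.inl ⟨unitInterval.nonneg', unitInterval.nonneg'⟩
    | exact Or.inl ⟨unitInterval.le_one', unitInterval.le_one'⟩
    | exact Or.inr ⟨by assumption, by assumption⟩
    | exact Or.inr ⟨h0.trans h1, t0.trans t1⟩
  rcases key with ⟨p, q⟩ | ⟨p, q⟩
  · rw [inf_eq_left.mpr p, inf_eq_left.mpr q, sup_eq_right.mpr p, sup_eq_right.mpr q,
      gimp_of_le p, gimp_of_le q]
    exact ⟨ha, ha', Or.inr (Or.inr ⟨rfl, rfl⟩)⟩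
  · rw [inf_eq_right.mpr p.le, inf_eq_right.mpr q.le, sup_eq_left.mpr p.le, sup_eq_left.mpr q.le,
      gimp_of_lt p, gimp_of_lt q]
    exact ⟨ha', ha, ha'⟩

theorem box_not_definable_from_diamond :
    ((0,0,0) : G3) ∈ S12 ∧ ((1,1,1) : G3) ∈ S12 ∧ ((0,uhalf,uthird) : G3) ∈ S12 ∧
    (∀ x ∈ S12, ∀ y ∈ S12, x ⊓ y ∈ S12 ∧ x ⊔ y ∈ S12 ∧ gimp3 x y ∈ S12) ∧
    (∀ x ∈ S12, dia3 x ∈ S12) ∧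
    box3 (0,uhalf,uthird) = (uthird,1,1) ∧ box3 (0,uhalf,uthird) ∉ S12 := by
  have hbox : box3 (0, uhalf, uthird) = (uthird, 1, 1) :=
    congrArg (·, 1, 1) (inf_eq_right.mpr uthird_lt_uhalf.le)
  refine ⟨by simp [mem_S12_iff], by simp [mem_S12_iff], by simp [mem_S12_iff], ?_, ?_, hbox, ?_⟩
  · rintro ⟨a, b, c⟩ hx ⟨a', b', c'⟩ hy
    rw [mem_S12_iff] at hx hy
    have h₁ := parallel_chains_closed uhalf_pos uhalf_lt_one uhalf_pos uhalf_lt_one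
      (a := a) (b := a) (a' := a') (b' := a') (by simpa using hx.1) (by simpa using hy.1)
    simp only [and_self] at h₁
    have h₂ := parallel_chains_closed uhalf_pos uhalf_lt_one uthird_pos uthird_lt_one hx.2 hy.2
    exact ⟨(mem_S12_iff _ _ _).mpr ⟨h₁.1, h₂.1⟩, (mem_S12_iff _ _ _).mpr ⟨h₁.2.1, h₂.2.1⟩,
      (mem_S12_iff _ _ _).mpr ⟨h₁.2.2, h₂.2.2⟩⟩
  · rintro ⟨a, b, c⟩ hx
    rw [mem_S12_iff] at hx
    refine (mem_S12_iff _ _ _).mpr ⟨?_, Or.inl ⟨rfl, rfl⟩⟩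
    rcases hx.2 with ⟨rfl, rfl⟩ | ⟨rfl, rfl⟩ | ⟨rfl, rfl⟩
    · exact Or.inl (sup_idem _)
    · exact Or.inr (Or.inl (sup_eq_left.mpr uthird_lt_uhalf.le))
    · exact Or.inr (Or.inr (sup_idem _))
  · rw [hbox, mem_S12_iff]
    rintro ⟨h | h | h, -⟩
    · exact uthird_pos.ne' h
    · exact uthird_lt_uhalf.ne h
    · exact uthird_lt_one.ne h
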